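/- arXiv:1606.09047 — 3 statements merged into one kernel-verified Lean document; each statement's English description precedes it below -/
import Mathlib

section
/- Let h : ℝ → ℝ be a real-valued even Schwartz function (h(−t) = h(t) for all t), and let W_h(τ, η) := ∫_ℝ h(τ + t/2)·conj(h(τ − t/2))·exp(−2πi η t) dt be its Wigner–Ville distribution. Then for every c ∈ ℝ, ∫_ℝ τ · W_h(τ, c·τ) dτ = 0. -/
open MeasureTheory

/-- The Wigner–Ville distribution of `f : ℝ → ℂ`. -/
noncomputable def WVD (f : ℝ → ℂ) (τ η : ℝ) : ℂ :=
  ∫ t : ℝ, f (τ + t / 2) * (starRingEnd ℂ) (f (τ - t / 2)) *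
    Complex.exp (-(2 * Real.pi * η * t : ℝ) * Complex.I)

/-- The Wigner–Ville distribution of an even function is invariant under `(τ, η) ↦ (-τ, -η)`. -/
theorem WVD_neg_neg_of_even {f : ℝ → ℂ} (hf : f.Even) (τ η : ℝ) :
    WVD f (-τ) (-η) = WVD f τ η := by
  unfold WVD
  rw [← integral_neg_eq_self]
  refine integral_congr_ae (.of_forall fun t => ?_)
  have h₁ : f (-τ + -t / 2) = f (τ + t / 2) := by
    rw [← hf]; congr 1; ring
  have h₂ : f (-τ - -t / 2) = f (τ - t / 2) := by
    rw [← hf]; congr 1; ring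
  simp only [h₁, h₂, mul_neg, neg_mul, neg_neg]

/-- The integral of an odd function vanishes. -/
theorem integral_eq_zero_of_odd {g : ℝ → ℂ} (hg : g.Odd) : ∫ x, g x = 0 := by
  have h := integral_neg_eq_self g volume
  simp only [hg _, integral_neg] at h
  exact neg_eq_self.mp h

theorem stmt9 (h : SchwartzMap ℝ ℝ) (heven : ∀ t : ℝ, h (-t) = h t) (c : ℝ) :
    ∫ τ : ℝ, (τ : ℂ) * WVD (fun t => (h t : ℂ)) τ (c * τ) = 0 := by
  refine integral_eq_zero_of_odd fun τ => ?_
  have hf : (fun t => (h t : ℂ)).Even := fun t => by simp only [heven]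
  rw [mul_neg, WVD_neg_neg_of_even hf, Complex.ofReal_neg, neg_mul]
end

section
/- Let h : ℝ → ℝ be a real-valued Schwartz function and a, b, t₀, ξ ∈ ℝ. Let x₀(s) := exp(2πi(a·s²/2 + b·s)), and let Th(t) := t·h(t). Define V_x^{(g)}(t, ξ) := ∫_ℝ x(s)·g(s − t)·exp(−2πi ξ s) ds and W_h(τ, η) := ∫_ℝ h(τ + t/2)·conj(h(τ − t/2))·exp(−2πi η t) dt. Then Re( V_{x₀}^{(Th)}(t₀, ξ) · conj(V_{x₀}^{(h)}(t₀, ξ)) ) = ∫_ℝ τ · W_h(τ, a·(τ + t₀) + b − ξ) dτ. Consequently, whenever V_{x₀}^{(h)}(t₀, ξ) ≠ 0, the STFT group delay Γ(t₀, ξ) := Re( V_{x₀}^{(Th)}(t₀, ξ) / V_{x₀}^{(h)}(t₀, ξ) ) equals (∫_ℝ τ·W_h(τ, a·(τ+t₀)+b−ξ) dτ) / (∫_ℝ W_h(τ, a·(τ+t₀)+b−ξ) dτ). -/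
open MeasureTheory

/-- The short-time Fourier transform of `x` with window `g`. -/
noncomputable def STFT (x g : ℝ → ℂ) (t ξ : ℝ) : ℂ :=
  ∫ s : ℝ, x s * g (s - t) * Complex.exp (-(2 * Real.pi * ξ * s : ℝ) * Complex.I)

/-- The linear chirp `x₀(s) = exp(2πi(a s²/2 + b s))`. -/
noncomputable def chirp (a b : ℝ) (s : ℝ) : ℂ :=
  Complex.exp (((2 * Real.pi * (a * s ^ 2 / 2 + b * s) : ℝ) : ℂ) * Complex.I)

/-- Integrating over the midpoint `τ` and the difference `t` of two points is integrating over the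
two points. -/
theorem integral_integral_midpoint_diff {K : ℝ × ℝ → ℂ} (hK : Integrable K) :
    ∫ τ : ℝ, ∫ t : ℝ, K (τ - t / 2, τ + t / 2) = ∫ p, K p := by
  have inner_integral (τ : ℝ) :
      ∫ t : ℝ, K (τ - t / 2, τ + t / 2) = (2 : ℝ) • ∫ s : ℝ, K (s, 2 * τ - s) := by
    rw [← integral_sub_left_eq_self (fun s => K (s, 2 * τ - s)) volume τ]
    have hscale := Measure.integral_comp_mul_left
      (fun s : ℝ => K (τ - s, 2 * τ - (τ - s))) (1 / 2)
    rw [show |((1 / 2 : ℝ))⁻¹| = 2 by norm_num] at hscale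
    rw [← hscale]
    refine integral_congr_ae (.of_forall fun t => ?_)
    dsimp only
    ring_nf
  have hshear : Integrable
      (Function.uncurry fun s z : ℝ => K (s, z - s)) (volume.prod volume) := by
    have := (measurePreserving_prod_neg_add (volume : Measure ℝ) (volume : Measure ℝ)
      ).integrable_comp_of_integrable hK
    refine this.congr (.of_forall fun p => ?_)
    simp [Function.uncurry, sub_eq_neg_add]
  calc ∫ τ : ℝ, ∫ t : ℝ, K (τ - t / 2, τ + t / 2)
      = (2 : ℝ) • ∫ τ : ℝ, ∫ s : ℝ, K (s, 2 * τ - s) := by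
        simp_rw [inner_integral]
        exact integral_smul _ _
    _ = ∫ z : ℝ, ∫ s : ℝ, K (s, z - s) := by
        rw [Measure.integral_comp_mul_left (fun z : ℝ => ∫ s : ℝ, K (s, z - s)) 2, smul_smul]
        norm_num
    _ = ∫ s : ℝ, ∫ z : ℝ, K (s, z - s) := (integral_integral_swap hshear).symm
    _ = ∫ s : ℝ, ∫ v : ℝ, K (s, v) := by
        refine integral_congr_ae (.of_forall fun s => ?_)
        exact integral_sub_right_eq_self (fun v => K (s, v)) s
    _ = ∫ p, K p := (integral_prod K hK).symm

/-- The linear chirp demodulated at frequency `ξ` and recentred at `t`. -/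
noncomputable def demodulatedChirp (a b t ξ u : ℝ) : ℂ :=
  Complex.exp ((2 * Real.pi * (a * (u + t) ^ 2 / 2 + (b - ξ) * (u + t)) : ℝ) * Complex.I)

theorem norm_demodulatedChirp (a b t ξ u : ℝ) : ‖demodulatedChirp a b t ξ u‖ = 1 :=
  Complex.norm_exp_ofReal_mul_I _

theorem continuous_demodulatedChirp (a b t ξ : ℝ) : Continuous (demodulatedChirp a b t ξ) := by
  unfold demodulatedChirp
  fun_prop

theorem STFT_chirp (a b t ξ : ℝ) (g : ℝ → ℂ) :
    STFT (chirp a b) g t ξ = ∫ u : ℝ, g u * demodulatedChirp a b t ξ u := by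
  unfold STFT
  rw [← integral_add_right_eq_self _ t]
  refine integral_congr_ae (.of_forall fun u => ?_)
  simp only [chirp, demodulatedChirp, add_sub_cancel_right]
  rw [mul_comm (Complex.exp _), mul_assoc, ← Complex.exp_add]
  congr 2
  push_cast
  ring

theorem demodulatedChirp_mul_conj (a b t ξ τ s : ℝ) :
    demodulatedChirp a b t ξ (τ - s / 2) * (starRingEnd ℂ) (demodulatedChirp a b t ξ (τ + s / 2)) =
      Complex.exp (-(2 * Real.pi * (a * (τ + t) + b - ξ) * s : ℝ) * Complex.I) := by
  unfold demodulatedChirp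
  rw [← Complex.exp_conj, map_mul, Complex.conj_ofReal, Complex.conj_I, ← Complex.exp_add]
  congr 1
  push_cast
  ring

theorem MeasureTheory.Integrable.mul_demodulatedChirp {g : ℝ → ℂ} (hg : Integrable g)
    (a b t ξ : ℝ) : Integrable fun u => g u * demodulatedChirp a b t ξ u :=
  hg.mul_bdd (c := 1) (continuous_demodulatedChirp a b t ξ).aestronglyMeasurable
    (.of_forall fun u => (norm_demodulatedChirp a b t ξ u).le)

theorem WVD_ofReal (h : ℝ → ℝ) (a b t ξ τ : ℝ) :
    WVD (fun s => (h s : ℂ)) τ (a * (τ + t) + b - ξ) =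
      ∫ s : ℝ, (h (τ - s / 2) * demodulatedChirp a b t ξ (τ - s / 2)) *
        (starRingEnd ℂ) (h (τ + s / 2) * demodulatedChirp a b t ξ (τ + s / 2)) := by
  unfold WVD
  refine integral_congr_ae (.of_forall fun s => ?_)
  dsimp only
  rw [← demodulatedChirp_mul_conj, map_mul, Complex.conj_ofReal, Complex.conj_ofReal]
  ring

theorem MeasureTheory.Integrable.mul_conj_prod {f g : ℝ → ℂ} (hf : Integrable f)
    (hg : Integrable g) : Integrable fun p : ℝ × ℝ => f p.1 * (starRingEnd ℂ) (g p.2) :=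
  hf.mul_prod (Complex.conjLIE.integrable_comp_iff.2 hg)

theorem integral_mul_conj_prod (f g : ℝ → ℂ) :
    ∫ p : ℝ × ℝ, f p.1 * (starRingEnd ℂ) (g p.2) = (∫ u, f u) * (starRingEnd ℂ) (∫ u, g u) := by
  rw [← integral_conj]
  exact integral_prod_mul f fun v => (starRingEnd ℂ) (g v)

theorem integral_WVD_chirp {h : ℝ → ℝ} (hh : Integrable h) (a b t ξ : ℝ) :
    ∫ τ : ℝ, WVD (fun s => (h s : ℂ)) τ (a * (τ + t) + b - ξ) =
      STFT (chirp a b) (fun s => (h s : ℂ)) t ξ *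
        (starRingEnd ℂ) (STFT (chirp a b) (fun s => (h s : ℂ)) t ξ) := by
  have hF := (hh.ofReal (𝕜 := ℂ)).mul_demodulatedChirp a b t ξ
  simp_rw [WVD_ofReal]
  rw [STFT_chirp, ← integral_mul_conj_prod]
  exact integral_integral_midpoint_diff (hF.mul_conj_prod hF)

open ComplexConjugate in
theorem integral_mul_WVD_chirp {h : ℝ → ℝ} (hh : Integrable h)
    (hTh : Integrable fun s => s * h s) (a b t ξ : ℝ) :
    ∫ τ : ℝ, (τ : ℂ) * WVD (fun s => (h s : ℂ)) τ (a * (τ + t) + b - ξ) =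
      ((STFT (chirp a b) (fun s => ((s * h s : ℝ) : ℂ)) t ξ *
        (starRingEnd ℂ) (STFT (chirp a b) (fun s => (h s : ℂ)) t ξ)).re : ℝ) := by
  let F : ℝ → ℂ := fun u => h u * demodulatedChirp a b t ξ u
  let G : ℝ → ℂ := fun u => (u * h u : ℝ) * demodulatedChirp a b t ξ u
  have hF : Integrable F := hh.ofReal.mul_demodulatedChirp a b t ξ
  have hG : Integrable G := hTh.ofReal.mul_demodulatedChirp a b t ξ
  have hGF := hG.mul_conj_prod hF
  have hFG := hF.mul_conj_prod hG
  calc ∫ τ : ℝ, (τ : ℂ) * WVD (fun s => (h s : ℂ)) τ (a * (τ + t) + b - ξ)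
      = ∫ τ : ℝ, ∫ s : ℝ,
          (fun p : ℝ × ℝ => (G p.1 * conj (F p.2) + F p.1 * conj (G p.2)) / 2)
            (τ - s / 2, τ + s / 2) := by
        simp_rw [WVD_ofReal, ← integral_const_mul]
        refine integral_congr_ae (.of_forall fun τ => integral_congr_ae (.of_forall fun s => ?_))
        simp only [F, G, map_mul, Complex.conj_ofReal]
        push_cast
        ring
    _ = ((∫ u, G u) * conj (∫ u, F u) + (∫ u, F u) * conj (∫ u, G u)) / 2 := by
        rw [← integral_mul_conj_prod, ← integral_mul_conj_prod, ← integral_add hGF hFG,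
          ← integral_div]
        exact integral_integral_midpoint_diff ((hGF.add hFG).div_const 2)
    _ = _ := by
        rw [Complex.re_eq_add_conj, STFT_chirp, STFT_chirp, map_mul, Complex.conj_conj,
          mul_comm (conj (∫ u, G u))]

theorem stmt14 (h : SchwartzMap ℝ ℝ) (a b t₀ ξ : ℝ) :
    ((((STFT (chirp a b) (fun t => ((t * h t : ℝ) : ℂ)) t₀ ξ
        * (starRingEnd ℂ) (STFT (chirp a b) (fun t => (h t : ℂ)) t₀ ξ)).re : ℝ) : ℂ)
      = ∫ τ : ℝ, (τ : ℂ) * WVD (fun t => (h t : ℂ)) τ (a * (τ + t₀) + b - ξ))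
    ∧ (STFT (chirp a b) (fun t => (h t : ℂ)) t₀ ξ ≠ 0 →
        (((STFT (chirp a b) (fun t => ((t * h t : ℝ) : ℂ)) t₀ ξ
            / STFT (chirp a b) (fun t => (h t : ℂ)) t₀ ξ).re : ℝ) : ℂ)
          = (∫ τ : ℝ, (τ : ℂ) * WVD (fun t => (h t : ℂ)) τ (a * (τ + t₀) + b - ξ))
            / (∫ τ : ℝ, WVD (fun t => (h t : ℂ)) τ (a * (τ + t₀) + b - ξ))) := by
  have hTh : Integrable fun s : ℝ => s * h s :=
    (h.integrable_pow_mul volume 1).mono'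
      (continuous_id.mul h.continuous).aestronglyMeasurable (.of_forall fun s => by simp)
  rw [integral_mul_WVD_chirp h.integrable hTh, integral_WVD_chirp h.integrable]
  refine ⟨rfl, fun _ => ?_⟩
  rw [Complex.mul_conj, ← Complex.ofReal_div, div_eq_mul_inv, Complex.inv_def, ← mul_assoc,
    Complex.re_mul_ofReal, div_eq_mul_inv]
end

section
/- Let h : ℝ → ℝ be a real-valued even Schwartz function (h(−t) = h(t) for all t), let Th(t) := t·h(t), let f, t, η ∈ ℝ, and let x(s) := exp(2πi f s). Then Re( V_x^{(Th)}(t, η) · conj(V_x^{(h)}(t, η)) ) = 0, where V_x^{(g)}(t, η) := ∫_ℝ x(s)·g(s − t)·exp(−2πi η s) ds. In particular, whenever V_x^{(h)}(t, η) ≠ 0, the STFT group delay Re( V_x^{(Th)}(t, η)/V_x^{(h)}(t, η) ) equals 0. -/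
open MeasureTheory

/-- The STFT of a pure tone is, up to a phase, the Fourier integral of the window. -/
theorem STFT_tone (g : ℝ → ℂ) (f t η : ℝ) :
    STFT (fun s => Complex.exp (((2 * Real.pi * f * s : ℝ) : ℂ) * Complex.I)) g t η
      = Complex.exp (((2 * Real.pi * (f - η) * t : ℝ) : ℂ) * Complex.I)
        * ∫ u : ℝ, g u * Complex.exp (((2 * Real.pi * (f - η) * u : ℝ) : ℂ) * Complex.I) := by
  unfold STFT
  rw [← integral_add_right_eq_self _ t, ← integral_const_mul]
  refine integral_congr_ae (.of_forall fun u => ?_)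
  simp only [add_sub_cancel_right]
  rw [mul_right_comm, ← Complex.exp_add, mul_left_comm, ← Complex.exp_add, mul_comm (g u)]
  congr 2
  push_cast
  ring

/-- Conjugating the Fourier integral of a real window amounts to reflecting the window. -/
theorem conj_integral_mul_exp (g : ℝ → ℝ) (k : ℝ) :
    (starRingEnd ℂ) (∫ u : ℝ, (g u : ℂ) * Complex.exp (((k * u : ℝ) : ℂ) * Complex.I))
      = ∫ u : ℝ, (g (-u) : ℂ) * Complex.exp (((k * u : ℝ) : ℂ) * Complex.I) := by
  rw [← integral_conj, ← integral_neg_eq_self]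
  refine integral_congr_ae (.of_forall fun u => ?_)
  simp [← Complex.exp_conj]

theorem stmt18 (h : SchwartzMap ℝ ℝ) (heven : ∀ s : ℝ, h (-s) = h s) (f t η : ℝ) :
    ((STFT (fun s => Complex.exp (((2 * Real.pi * f * s : ℝ) : ℂ) * Complex.I))
          (fun s => ((s * h s : ℝ) : ℂ)) t η
        * (starRingEnd ℂ)
            (STFT (fun s => Complex.exp (((2 * Real.pi * f * s : ℝ) : ℂ) * Complex.I))
              (fun s => (h s : ℂ)) t η)).re = 0)
    ∧ (STFT (fun s => Complex.exp (((2 * Real.pi * f * s : ℝ) : ℂ) * Complex.I))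
          (fun s => (h s : ℂ)) t η ≠ 0 →
        (STFT (fun s => Complex.exp (((2 * Real.pi * f * s : ℝ) : ℂ) * Complex.I))
            (fun s => ((s * h s : ℝ) : ℂ)) t η
          / STFT (fun s => Complex.exp (((2 * Real.pi * f * s : ℝ) : ℂ) * Complex.I))
              (fun s => (h s : ℂ)) t η).re = 0) := by
  have key :
      (STFT (fun s => Complex.exp (((2 * Real.pi * f * s : ℝ) : ℂ) * Complex.I))
          (fun s => ((s * h s : ℝ) : ℂ)) t η
        * (starRingEnd ℂ)
            (STFT (fun s => Complex.exp (((2 * Real.pi * f * s : ℝ) : ℂ) * Complex.I))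
              (fun s => (h s : ℂ)) t η)).re = 0 := by
    have hV := conj_integral_mul_exp h (2 * Real.pi * (f - η))
    have hTV := conj_integral_mul_exp (fun s => s * h s) (2 * Real.pi * (f - η))
    simp only [heven, neg_mul, Complex.ofReal_neg, integral_neg] at hV hTV
    rw [STFT_tone, STFT_tone]
    have hre := congrArg Complex.re hTV
    have him := congrArg Complex.im hV
    rw [Complex.conj_re, Complex.neg_re] at hre
    rw [Complex.conj_im] at him
    rw [map_mul, mul_mul_mul_comm, Complex.mul_conj, Complex.re_ofReal_mul, Complex.mul_re,
      Complex.conj_re, Complex.conj_im, self_eq_neg.mp hre, neg_eq_self.mp him]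
    simp
  refine ⟨key, fun _ => ?_⟩
  rw [div_eq_mul_inv, Complex.inv_def, ← mul_assoc, Complex.re_mul_ofReal, key, zero_mul]
end
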